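/- Let G and H be finite groups of coprime orders, K := ℚ(G) and L := ℚ(H). Then ℚ(G × H) = KL (the compositum inside ℂ), the ring of integers of KL equals the subring of ℂ generated by ℤ_K and ℤ_L, and ℤ[G × H] equals the subring of ℂ generated by ℤ[G] and ℤ[H] (equivalently, the set of finite sums of products xy with x ∈ ℤ[G], y ∈ ℤ[H]). -/

import Mathlib

open CategoryTheory Module Pointwise
open scoped MatrixGroups

/-- The set of all values `χ(g)` of irreducible complex characters `χ` of `G`. -/
noncomputable def charValues (G : Type) [Group G] : Set ℂ :=
  {z : ℂ | ∃ V : FDRep ℂ G, Simple V ∧ ∃ g : G, V.character g = z}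

/-- `ℚ(G)`, the field of character values of `G`, as a subfield of `ℂ`. -/
noncomputable def charField (G : Type) [Group G] : Subfield ℂ :=
  Subfield.closure (charValues G)

/-- `ℤ[G]`, the subring of `ℂ` generated by the character values of `G`. -/
noncomputable def charRing (G : Type) [Group G] : Subring ℂ :=
  Subring.closure (charValues G)

/-- The ring of integers of a subfield `K` of `ℂ`, i.e. the elements of `K` integral
over `ℤ`, as a subring of `ℂ`. -/
noncomputable def ringOfIntIn (K : Subfield ℂ) : Subring ℂ :=
  (integralClosure ℤ ℂ).toSubring ⊓ K.toSubring

/-- The additive quotient group `ℤ_{ℚ(G)}/ℤ[G]`. -/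
noncomputable def charQuot (G : Type) [Group G] :=
  ↥((ringOfIntIn (charField G)).toAddSubgroup) ⧸
    ((charRing G).toAddSubgroup.addSubgroupOf (ringOfIntIn (charField G)).toAddSubgroup)

noncomputable instance (G : Type) [Group G] : AddCommGroup (charQuot G) := by
  unfold charQuot; infer_instance

/-- The `m`-th cyclotomic field `ℚ(ζ_m)`, as the subfield of `ℂ` generated by the
`m`-th roots of unity. -/
noncomputable def cycField (m : ℕ) : Subfield ℂ :=
  Subfield.closure {z : ℂ | z ^ m = 1}

/-- The set of values `χ(g)` at a fixed `g` of irreducible complex characters `χ` of `G`. -/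
noncomputable def charValuesAt {G : Type} [Group G] (g : G) : Set ℂ :=
  {z : ℂ | ∃ V : FDRep ℂ G, Simple V ∧ V.character g = z}

/-- `ℚ(g)`, the subfield of `ℂ` generated by one column of the character table. -/
noncomputable def charFieldAt {G : Type} [Group G] (g : G) : Subfield ℂ :=
  Subfield.closure (charValuesAt g)

/-- `ℤ[g]`, the subring of `ℂ` generated by one column of the character table. -/
noncomputable def charRingAt {G : Type} [Group G] (g : G) : Subring ℂ :=
  Subring.closure (charValuesAt g)

section Representations

open TensorProduct Representation

/-- An irreducible complex representation of a finite group gives a simple object of `FDRep`. -/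
theorem FDRep.simple_of_isIrreducible {G V : Type} [Group G] [Finite G] [AddCommGroup V]
    [Module ℂ V] [FiniteDimensional ℂ V] (ρ : Representation ℂ G V) [IsIrreducible ρ] :
    Simple (FDRep.of ρ) := by
  classical
  have := Fintype.ofFinite G
  have hG : (Nat.card G : ℂ) ≠ 0 := NeZero.ne _
  have := invertibleOfNonzero hG
  rw [FDRep.simple_iff_char_is_norm_one]
  have h := Representation.char_orthonormal ρ ρ
  rw [if_pos ⟨Representation.Equiv.refl ρ⟩, inv_mul_eq_one₀ hG] at h
  exact h.symm

/-- Every nonzero finite-dimensional representation has an irreducible subrepresentation. -/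
theorem Representation.exists_isIrreducible_toRepresentation {G V : Type*} [Group G]
    [AddCommGroup V] [Module ℂ V] [FiniteDimensional ℂ V] [Nontrivial V]
    (ρ : Representation ℂ G V) :
    ∃ σ : Subrepresentation ρ, IsIrreducible σ.toRepresentation := by
  obtain ⟨σ, hσ, hmin⟩ := exists_minimalFor_of_wellFoundedLT
    (fun σ : Subrepresentation ρ ↦ σ.toSubmodule ≠ ⊥)
    (fun σ ↦ σ.toSubmodule) ⟨⟨⊤, fun _ _ _ ↦ Submodule.mem_top⟩, by simp⟩
  have : Nontrivial σ.toSubmodule := Submodule.nontrivial_iff_ne_bot.mpr hσ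
  have : Nontrivial (Subrepresentation σ.toRepresentation) := by
    refine ⟨⟨⟨⊥, ?_⟩, ⟨⊤, fun _ _ _ ↦ Submodule.mem_top⟩, fun h ↦ ?_⟩⟩
    · intro g v hv
      simp_all
    · exact bot_ne_top (congrArg Subrepresentation.toSubmodule h)
  refine ⟨σ, ⟨fun τ ↦ ?_⟩⟩
  by_cases hτ : τ.toSubmodule = ⊥
  · left
    exact Subrepresentation.toSubmodule_injective hτ
  · right
    have h := hmin (j := ⟨τ.toSubmodule.map σ.toSubmodule.subtype, ?_⟩) ?_
      (Submodule.map_subtype_le _ _)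
    · apply Subrepresentation.toSubmodule_injective
      refine eq_top_iff.mpr fun x _ ↦ ?_
      obtain ⟨y, hy, hyx⟩ := h x.2
      rwa [← Subtype.ext hyx]
    · rintro g _ ⟨y, hy, rfl⟩
      exact ⟨_, τ.apply_mem_toSubmodule g hy, rfl⟩
    · intro h
      refine hτ (Submodule.map_injective_of_injective σ.toSubmodule.subtype_injective ?_)
      exact h.trans (Submodule.map_bot _).symm

/-- The external tensor product of two representations. -/
noncomputable abbrev Representation.externalTensor {k G H V W : Type*} [CommSemiring k] [Monoid G]
    [Monoid H] [AddCommMonoid V] [Module k V] [AddCommMonoid W] [Module k W]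
    (ρ : Representation k G V) (σ : Representation k H W) : Representation k (G × H) (V ⊗[k] W) :=
  tprod (ρ.comp (MonoidHom.fst G H)) (σ.comp (MonoidHom.snd G H))

theorem Representation.character_externalTensor {k G H V W : Type*} [Field k] [Group G]
    [Group H] [AddCommGroup V] [Module k V] [FiniteDimensional k V] [AddCommGroup W] [Module k W]
    [FiniteDimensional k W] (ρ : Representation k G V) (σ : Representation k H W) (x : G × H) :
    (ρ.externalTensor σ).character x = ρ.character x.1 * σ.character x.2 := by
  rw [externalTensor, char_tensor]
  rfl

/-- The external tensor product of simple representations is simple. -/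
theorem FDRep.simple_externalTensor {G H : Type} [Group G] [Group H] [Finite G] [Finite H]
    (V : FDRep ℂ G) (W : FDRep ℂ H) [hV : Simple V] [hW : Simple W] :
    Simple (FDRep.of (externalTensor V.ρ W.ρ)) := by
  have := Fintype.ofFinite G
  have := Fintype.ofFinite H
  rw [FDRep.simple_iff_char_is_norm_one] at hV hW ⊢
  rw [Nat.card_prod, Nat.cast_mul, ← hV, ← hW, Fintype.sum_mul_sum, Fintype.sum_prod_type]
  refine Finset.sum_congr rfl fun g _ ↦ Finset.sum_congr rfl fun h _ ↦ ?_
  have key (x : G × H) : (FDRep.of (externalTensor V.ρ W.ρ)).character x =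
    V.character x.1 * W.character x.2 := character_externalTensor V.ρ W.ρ x
  rw [key, key]
  simp only [Prod.fst_inv, Prod.snd_inv]
  ring

theorem FDRep.nontrivial_of_simple {G : Type} [Group G] [Finite G] (V : FDRep ℂ G)
    [hV : Simple V] : Nontrivial V := by
  have := Fintype.ofFinite G
  by_contra h
  rw [not_nontrivial_iff_subsingleton] at h
  rw [FDRep.simple_iff_char_is_norm_one] at hV
  have h0 (g : G) : V.character g = 0 := by
    rw [FDRep.character, Subsingleton.elim (V.ρ g) 0, map_zero]
  simp only [h0, mul_zero, Finset.sum_const_zero] at hV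
  exact NeZero.ne (Nat.card G : ℂ) hV.symm

/-- Simple representations admitting a nonzero intertwining map have the same character. -/
theorem FDRep.character_eq_of_intertwiningMap_ne_zero {G : Type} [Group G] [Finite G]
    (V W : FDRep ℂ G) [Simple V] [Simple W] (f : IntertwiningMap V.ρ W.ρ) (hf : f ≠ 0) :
    V.character = W.character := by
  have := Fintype.ofFinite G
  have hG : (Nat.card G : ℂ) ≠ 0 := NeZero.ne _
  have := invertibleOfNonzero hG
  have h₁ := Representation.card_inv_mul_sum_char_mul_char_eq_finrank V.ρ W.ρ
  have h₂ := FDRep.char_orthonormal W V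
  have : FiniteDimensional ℂ (IntertwiningMap V.ρ W.ρ) := inferInstance
  have h₃ : Module.finrank ℂ (IntertwiningMap V.ρ W.ρ) ≠ 0 :=
    (Module.finrank_pos_iff_exists_ne_zero.mpr ⟨f, hf⟩).ne'
  by_cases h : Nonempty (W ≅ V)
  · exact (FDRep.char_iso h.some).symm
  · rw [if_neg h] at h₂
    exact absurd (Nat.cast_eq_zero.mp (h₁.symm.trans h₂)) h₃

/-- Every nonzero finite-dimensional representation receives a nonzero intertwining map from a
simple one. -/
theorem FDRep.exists_simple_intertwiningMap_ne_zero {G V : Type} [Group G] [Finite G]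
    [AddCommGroup V] [Module ℂ V] [FiniteDimensional ℂ V] [Nontrivial V]
    (ρ : Representation ℂ G V) :
    ∃ W : FDRep ℂ G, Simple W ∧ ∃ f : IntertwiningMap W.ρ ρ, f ≠ 0 := by
  obtain ⟨σ, hσ⟩ := exists_isIrreducible_toRepresentation ρ
  have hW := FDRep.simple_of_isIrreducible σ.toRepresentation
  have := FDRep.nontrivial_of_simple (FDRep.of σ.toRepresentation)
  refine ⟨_, hW, { σ.toSubmodule.subtype with isIntertwining' := fun g ↦ rfl }, fun h ↦ ?_⟩
  obtain ⟨w, hw⟩ := exists_ne (0 : σ.toSubmodule)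
  exact hw (Subtype.ext (congrArg (fun f : IntertwiningMap _ _ ↦ f.toLinearMap w) h))

/-- The action of `H` on the `G`-equivariant maps from a representation of `G` to a
representation of `G × H`. -/
def Representation.equivariantHom {G H V W : Type*} [Group G] [Group H]
    [AddCommGroup V] [Module ℂ V] [AddCommGroup W] [Module ℂ W] (σ : Representation ℂ G W)
    (ρ : Representation ℂ (G × H) V) :
    Subrepresentation (linHom (1 : Representation ℂ H W) (ρ.comp (MonoidHom.inr G H))) where
  toSubmodule :=
    { carrier := {f | ∀ g w, f (σ g w) = ρ (g, 1) (f w)}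
      add_mem' := fun ha hb g w ↦ by simp [ha g w, hb g w]
      zero_mem' := fun g w ↦ by simp
      smul_mem' := fun c f hf g w ↦ by simp [hf g w] }
  apply_mem_toSubmodule h f hf g w := by
    simp only [linHom_apply, MonoidHom.one_apply, LinearMap.comp_apply, MonoidHom.comp_apply,
      MonoidHom.inr_apply, Module.End.one_apply]
    rw [hf g w, ← Module.End.mul_apply, ← Module.End.mul_apply, ← map_mul, ← map_mul]
    simp

/-- The character of a simple representation of `G × H` is the product of characters of
simple representations of `G` and `H`. -/
theorem FDRep.exists_character_eq_mul {G H : Type} [Group G] [Group H] [Finite G] [Finite H]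
    (V : FDRep ℂ (G × H)) [Simple V] :
    ∃ (W : FDRep ℂ G) (U : FDRep ℂ H), Simple W ∧ Simple U ∧
      ∀ x : G × H, V.character x = W.character x.1 * U.character x.2 := by
  have := FDRep.nontrivial_of_simple V
  obtain ⟨W, hW, i, hi⟩ :=
    FDRep.exists_simple_intertwiningMap_ne_zero (V.ρ.comp (MonoidHom.inl G H))
  let E := equivariantHom W.ρ V.ρ
  have : Nontrivial E.toSubmodule := by
    refine ⟨⟨⟨i.toLinearMap, fun g w ↦ LinearMap.congr_fun (i.isIntertwining' g) w⟩, 0,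
      fun h ↦ hi ?_⟩⟩
    exact IntertwiningMap.toLinearMap_injective _ _ (congrArg Subtype.val h)
  obtain ⟨U, hU, j, hj⟩ := FDRep.exists_simple_intertwiningMap_ne_zero E.toRepresentation
  refine ⟨W, U, hW, hU, fun x ↦ ?_⟩
  let f : W ⊗[ℂ] U →ₗ[ℂ] V := TensorProduct.lift (E.toSubmodule.subtype ∘ₗ j.toLinearMap).flip
  have := FDRep.simple_externalTensor W U
  let F : IntertwiningMap (externalTensor W.ρ U.ρ) V.ρ :=
    { f with
      isIntertwining' := by
        rintro ⟨g, h⟩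
        refine TensorProduct.ext' fun w u ↦ ?_
        have hj' : j.toLinearMap (U.ρ h u) = E.toRepresentation h (j.toLinearMap u) :=
          LinearMap.congr_fun (j.isIntertwining' h) u
        change (j.toLinearMap (U.ρ h u)).1 (W.ρ g w) = V.ρ (g, h) ((j.toLinearMap u).1 w)
        rw [hj']
        change V.ρ (1, h) ((j.toLinearMap u).1 (W.ρ g w)) = _
        rw [(j.toLinearMap u).2 g w, ← Module.End.mul_apply, ← map_mul]
        simp }
  rw [← FDRep.character_eq_of_intertwiningMap_ne_zero (FDRep.of (externalTensor W.ρ U.ρ)) V F ?_]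
  · exact character_externalTensor W.ρ U.ρ x
  · intro hF
    refine hj (IntertwiningMap.toLinearMap_injective _ _ ?_)
    refine LinearMap.ext fun u ↦ Subtype.ext (LinearMap.ext fun w ↦ ?_)
    exact congrArg (fun F' : IntertwiningMap _ _ ↦ F'.toLinearMap (w ⊗ₜ u)) hF

/-- The trivial one-dimensional representation is simple. -/
theorem FDRep.simple_trivial (G : Type) [Group G] [Finite G] :
    Simple (FDRep.of (1 : Representation ℂ G ℂ)) := by
  have := Fintype.ofFinite G
  rw [FDRep.simple_iff_char_is_norm_one]
  simp [FDRep.character]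

theorem charValues_prod (G H : Type) [Group G] [Group H] [Finite G] [Finite H] :
    charValues (G × H) = charValues G * charValues H := by
  ext z
  constructor
  · rintro ⟨V, hV, x, rfl⟩
    obtain ⟨W, U, hW, hU, h⟩ := FDRep.exists_character_eq_mul V
    exact ⟨_, ⟨W, hW, x.1, rfl⟩, _, ⟨U, hU, x.2, rfl⟩, (h x).symm⟩
  · rintro ⟨_, ⟨W, hW, g, rfl⟩, _, ⟨U, hU, h, rfl⟩, rfl⟩
    exact ⟨_, FDRep.simple_externalTensor W U, (g, h),
      character_externalTensor W.ρ U.ρ (g, h)⟩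

theorem one_mem_charValues (G : Type) [Group G] [Finite G] : 1 ∈ charValues G :=
  ⟨_, FDRep.simple_trivial G, 1, by simp [FDRep.character]⟩

/-- The trace of an endomorphism whose `n`-th power is the identity is a sum of `n`-th roots
of unity. -/
theorem LinearMap.trace_mem_of_pow_eq_one {k V : Type*} [Field k] [IsAlgClosed k]
    [AddCommGroup V] [Module k V] [FiniteDimensional k V] {S : Type*} [SetLike S k]
    [AddSubmonoidClass S k] (s : S) (n : ℕ) (hs : ∀ z : k, z ^ n = 1 → z ∈ s)
    (f : V →ₗ[k] V) (hf : f ^ n = 1) : LinearMap.trace k V f ∈ s := by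
  rw [Module.End.trace_eq_sum_roots_charpoly_of_splits (IsAlgClosed.splits _)]
  refine multiset_sum_mem _ fun z hz ↦ hs z ?_
  have hz' : Module.End.HasEigenvalue f z := by
    rw [Module.End.hasEigenvalue_iff_isRoot_charpoly]
    exact Polynomial.isRoot_of_mem_roots hz
  obtain ⟨v, hv⟩ := hz'.exists_hasEigenvector
  have := hv.pow_apply n
  rw [hf, Module.End.one_apply] at this
  by_contra hne
  refine hne (smul_left_injective k hv.2 ?_)
  simp [← this]

theorem charValues_subset_of_pow_card {G : Type} [Group G] [Finite G] {S : Type*} [SetLike S ℂ]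
    [AddSubmonoidClass S ℂ] (s : S) (hs : ∀ z : ℂ, z ^ Nat.card G = 1 → z ∈ s) :
    charValues G ⊆ s := by
  rintro _ ⟨V, -, g, rfl⟩
  exact LinearMap.trace_mem_of_pow_eq_one s _ hs _
    (by rw [← map_pow, pow_card_eq_one', map_one])

end Representations

section Arithmetic

open NumberField

/-- If two number fields embed in cyclotomic fields of coprime conductors, the ring of integers of
their compositum is generated by their rings of integers. -/
theorem NumberField.range_sup_range_ringOfIntegers_eq_top {L : Type*} [Field L] [NumberField L]
    (K₁ K₂ : IntermediateField ℚ L) (htop : K₁ ⊔ K₂ = ⊤) {n₁ n₂ : ℕ} [NeZero n₁] [NeZero n₂]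
    (h : n₁.Coprime n₂) {E₁ E₂ : Type*} [Field E₁] [Field E₂] [CharZero E₁] [CharZero E₂]
    [IsCyclotomicExtension {n₁} ℚ E₁] [IsCyclotomicExtension {n₂} ℚ E₂]
    (f₁ : K₁ →ₐ[ℚ] E₁) (f₂ : K₂ →ₐ[ℚ] E₂) :
    (IsScalarTower.toAlgHom ℤ (𝓞 K₁) (𝓞 L)).range ⊔
      (IsScalarTower.toAlgHom ℤ (𝓞 K₂) (𝓞 L)).range = ⊤ := by
  have : NumberField E₁ := IsCyclotomicExtension.numberField {n₁} ℚ E₁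
  have : NumberField E₂ := IsCyclotomicExtension.numberField {n₂} ℚ E₂
  have : IsAbelianGalois ℚ E₁ := IsCyclotomicExtension.isAbelianGalois {n₁} ℚ E₁
  have : IsAbelianGalois ℚ K₁ := IsAbelianGalois.of_algHom f₁
  have hE : IsCoprime (discr E₁) (discr E₂) := by
    rw [Int.isCoprime_iff_nat_coprime, IsCyclotomicExtension.Rat.natAbs_discr n₁ E₁,
      IsCyclotomicExtension.Rat.natAbs_discr n₂ E₂]
    refine Nat.Coprime.coprime_div_left ?_ (Nat.prod_primeFactors_pow_totient_ediv_dvd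
      (NeZero.pos _))
    refine Nat.Coprime.coprime_div_right ?_ (Nat.prod_primeFactors_pow_totient_ediv_dvd
      (NeZero.pos _))
    exact Nat.Coprime.pow_left _ (Nat.Coprime.pow_right _ h)
  have h₁ : discr K₁ ∣ discr E₁ := by
    let := f₁.toRingHom.toAlgebra
    exact discr_dvd_discr K₁ E₁
  have h₂ : discr K₂ ∣ discr E₂ := by
    let := f₂.toRingHom.toAlgebra
    exact discr_dvd_discr K₂ E₂
  have hK : IsCoprime (discr K₁) (discr K₂) :=
    (hE.of_isCoprime_of_dvd_left h₁).of_isCoprime_of_dvd_right h₂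
  exact IsDedekindDomain.range_sup_range_eq_top_of_isCoprime_differentIdeal ℤ (𝓞 L) (𝓞 K₁) (𝓞 K₂)
    (linearDisjoint_of_isGalois_isCoprime_discr L K₁ K₂ hK)
    (by rw [← IntermediateField.sup_toSubalgebra_of_left, htop]; rfl)
    (isCoprime_differentIdeal_of_isCoprime_discr L hK)

/-- The ring of integers of the compositum of two subfields of `ℂ` contained in cyclotomic fields
of coprime conductors. -/
theorem ringOfIntIn_sup_of_coprime (K₁ K₂ : IntermediateField ℚ ℂ) {n₁ n₂ : ℕ} [NeZero n₁]
    [NeZero n₂] (h : n₁.Coprime n₂) (h₁ : K₁ ≤ IntermediateField.adjoin ℚ {z : ℂ | z ^ n₁ = 1})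
    (h₂ : K₂ ≤ IntermediateField.adjoin ℚ {z : ℂ | z ^ n₂ = 1}) :
    ringOfIntIn (K₁ ⊔ K₂).toSubfield =
      Subring.closure
        ((ringOfIntIn K₁.toSubfield : Set ℂ) ∪ (ringOfIntIn K₂.toSubfield : Set ℂ)) := by
  have hcyc (n : ℕ) [NeZero n] :
      IsCyclotomicExtension {n} ℚ (IntermediateField.adjoin ℚ {z : ℂ | z ^ n = 1}) := by
    have h := IntermediateField.isCyclotomicExtension_adjoin_of_exists_isPrimitiveRoot {n} ℚ ℂ
      (fun _ h _ ↦ ⟨_, h ▸ Complex.isPrimitiveRoot_exp n (NeZero.ne n)⟩)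
    have hset : {b : ℂ | ∃ m ∈ ({n} : Set ℕ), m ≠ 0 ∧ b ^ m = 1} = {z : ℂ | z ^ n = 1} := by
      ext z
      simp [NeZero.ne n]
    rwa [hset] at h
  have := hcyc n₁
  have := hcyc n₂
  have := IsCyclotomicExtension.finiteDimensional {n₁} ℚ
    (IntermediateField.adjoin ℚ {z : ℂ | z ^ n₁ = 1})
  have := IsCyclotomicExtension.finiteDimensional {n₂} ℚ
    (IntermediateField.adjoin ℚ {z : ℂ | z ^ n₂ = 1})
  have : FiniteDimensional ℚ K₁ :=
    FiniteDimensional.of_injective (IntermediateField.inclusion h₁).toLinearMap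
      (IntermediateField.inclusion h₁).injective
  have : FiniteDimensional ℚ K₂ :=
    FiniteDimensional.of_injective (IntermediateField.inclusion h₂).toLinearMap
      (IntermediateField.inclusion h₂).injective
  have : FiniteDimensional ℚ ↥(K₁ ⊔ K₂) := IntermediateField.finiteDimensional_sup K₁ K₂
  have : NumberField ↥(K₁ ⊔ K₂) := { }
  let F₁ := IntermediateField.restrict (le_sup_left : K₁ ≤ K₁ ⊔ K₂)
  let F₂ := IntermediateField.restrict (le_sup_right : K₂ ≤ K₁ ⊔ K₂)
  have htop : F₁ ⊔ F₂ = ⊤ := by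
    apply IntermediateField.lift_injective
    rw [IntermediateField.lift_sup, IntermediateField.lift_top]
    simp [F₁, F₂, IntermediateField.lift_restrict]
  let g₁ : F₁ →ₐ[ℚ] IntermediateField.adjoin ℚ {z : ℂ | z ^ n₁ = 1} :=
    (IntermediateField.inclusion h₁).comp (IntermediateField.restrictAlgEquiv _).symm.toAlgHom
  let g₂ : F₂ →ₐ[ℚ] IntermediateField.adjoin ℚ {z : ℂ | z ^ n₂ = 1} :=
    (IntermediateField.inclusion h₂).comp (IntermediateField.restrictAlgEquiv _).symm.toAlgHom
  have key := NumberField.range_sup_range_ringOfIntegers_eq_top F₁ F₂ htop h g₁ g₂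
  apply le_antisymm
  · rintro x ⟨hx, hxK⟩
    have hy : IsIntegral ℤ (⟨x, hxK⟩ : ↥(K₁ ⊔ K₂)) :=
      (isIntegral_algebraMap_iff (algebraMap ↥(K₁ ⊔ K₂) ℂ).injective).mp hx
    let φ : 𝓞 ↥(K₁ ⊔ K₂) →ₐ[ℤ] ℂ :=
      ((K₁ ⊔ K₂).val.restrictScalars ℤ).comp (IsScalarTower.toAlgHom ℤ (𝓞 ↥(K₁ ⊔ K₂)) ↥(K₁ ⊔ K₂))
    have hφ : x ∈ (⊤ : Subalgebra ℤ (𝓞 ↥(K₁ ⊔ K₂))).map φ := ⟨⟨_, hy⟩, trivial, rfl⟩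
    rw [← key, Algebra.map_sup] at hφ
    refine (sup_le ?_ ?_ : _ ≤ subalgebraOfSubring (Subring.closure
      ((ringOfIntIn K₁.toSubfield : Set ℂ) ∪ (ringOfIntIn K₂.toSubfield : Set ℂ)))) hφ
    · rintro _ ⟨_, ⟨a, rfl⟩, rfl⟩
      exact Subring.subset_closure (Or.inl ⟨(RingOfIntegers.isIntegral _).map φ,
        (IntermediateField.mem_restrict _ _).mp (a : F₁).2⟩)
    · rintro _ ⟨_, ⟨a, rfl⟩, rfl⟩
      exact Subring.subset_closure (Or.inr ⟨(RingOfIntegers.isIntegral _).map φ,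
        (IntermediateField.mem_restrict _ _).mp (a : F₂).2⟩)
  · rw [Subring.closure_le, Set.union_subset_iff]
    refine ⟨fun x hx ↦ ⟨hx.1, ?_⟩, fun x hx ↦ ⟨hx.1, ?_⟩⟩
    · exact (le_sup_left : K₁ ≤ K₁ ⊔ K₂) hx.2
    · exact (le_sup_right : K₂ ≤ K₁ ⊔ K₂) hx.2

theorem IntermediateField.adjoin_rat_toSubfield {L : Type*} [Field L] [CharZero L] (S : Set L) :
    (IntermediateField.adjoin ℚ S).toSubfield = Subfield.closure S := by
  rw [IntermediateField.adjoin_toSubfield]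
  refine le_antisymm (Subfield.closure_le.mpr (Set.union_subset ?_ Subfield.subset_closure))
    (Subfield.closure_mono Set.subset_union_right)
  rintro _ ⟨q, rfl⟩
  simp

end Arithmetic

theorem Subfield.closure_mul_of_one_mem {L : Type*} [Field L] {S T : Set L} (hS : 1 ∈ S)
    (hT : 1 ∈ T) : Subfield.closure (S * T) = Subfield.closure S ⊔ Subfield.closure T := by
  apply le_antisymm
  · rw [Subfield.closure_le]
    rintro _ ⟨x, hx, y, hy, rfl⟩
    exact mul_mem ((le_sup_left : Subfield.closure S ≤ _) (Subfield.subset_closure hx))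
      ((le_sup_right : Subfield.closure T ≤ _) (Subfield.subset_closure hy))
  · exact sup_le (Subfield.closure_mono fun x hx ↦ ⟨x, hx, 1, hT, mul_one x⟩)
      (Subfield.closure_mono fun y hy ↦ ⟨1, hS, y, hy, one_mul y⟩)

theorem Subring.closure_mul_of_one_mem {R : Type*} [Ring R] {S T : Set R} (hS : 1 ∈ S)
    (hT : 1 ∈ T) : Subring.closure (S * T) = Subring.closure S ⊔ Subring.closure T := by
  apply le_antisymm
  · rw [Subring.closure_le]
    rintro _ ⟨x, hx, y, hy, rfl⟩
    exact mul_mem ((le_sup_left : Subring.closure S ≤ _) (Subring.subset_closure hx))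
      ((le_sup_right : Subring.closure T ≤ _) (Subring.subset_closure hy))
  · exact sup_le (Subring.closure_mono fun x hx ↦ ⟨x, hx, 1, hT, mul_one x⟩)
      (Subring.closure_mono fun y hy ↦ ⟨1, hS, y, hy, one_mul y⟩)

/-- For finite groups `G`, `H` of coprime orders with `K = ℚ(G)` and
`L = ℚ(H)`: `ℚ(G × H) = KL`, `ℤ_{KL} = ℤ_K·ℤ_L` and `ℤ[G × H] = ℤ[G]·ℤ[H]`. -/
theorem charField_prod_of_coprime (G H : Type) [Group G] [Group H] [Finite G] [Finite H]
    (hcop : Nat.Coprime (Nat.card G) (Nat.card H)) :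
    charField (G × H) = charField G ⊔ charField H ∧
    ringOfIntIn (charField G ⊔ charField H) =
      Subring.closure
        ((ringOfIntIn (charField G) : Set ℂ) ∪ (ringOfIntIn (charField H) : Set ℂ)) ∧
    charRing (G × H) =
      Subring.closure ((charRing G : Set ℂ) ∪ (charRing H : Set ℂ)) := by
  have hK (G : Type) [Group G] [Finite G] :
      IntermediateField.adjoin ℚ (charValues G) ≤
        IntermediateField.adjoin ℚ {z : ℂ | z ^ Nat.card G = 1} :=
    IntermediateField.adjoin_le_iff.mpr
      (charValues_subset_of_pow_card _ fun _ hz ↦ IntermediateField.subset_adjoin _ _ hz)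
  refine ⟨?_, ?_, ?_⟩
  · rw [charField, charValues_prod,
      Subfield.closure_mul_of_one_mem (one_mem_charValues G) (one_mem_charValues H)]
    rfl
  · have h := ringOfIntIn_sup_of_coprime _ _ hcop (hK G) (hK H)
    rwa [IntermediateField.sup_toSubfield, IntermediateField.adjoin_rat_toSubfield,
      IntermediateField.adjoin_rat_toSubfield] at h
  · rw [charRing, charValues_prod,
      Subring.closure_mul_of_one_mem (one_mem_charValues G) (one_mem_charValues H),
      Subring.closure_union, Subring.closure_eq, Subring.closure_eq]
    rfl
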